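/- Let α > β > 0 with α² + β² = 1, and let φ₁ = α|00⟩ + β|11⟩ and φ₂ = β|00⟩ + α|11⟩ in ℂ² ⊗ ℂ². Then the two-qubit density matrix ρ = (1/2)|φ₁⟩⟨φ₁| + (1/2)|φ₂⟩⟨φ₂| is not separable. -/

import Mathlib

open Matrix BigOperators ComplexOrder Kronecker

/-- A two-qubit density matrix is separable if it is a finite convex combination
of Kronecker products of pure-state projections `|x⟩⟨x| ⊗ |y⟩⟨y|`. -/
def IsSeparableState (ρ : Matrix (Fin 2 × Fin 2) (Fin 2 × Fin 2) ℂ) : Prop :=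
  ∃ (N : ℕ) (p : Fin N → ℝ) (x y : Fin N → (Fin 2 → ℂ)),
    (∀ k, 0 ≤ p k) ∧ (∑ k, p k = 1) ∧
    (∀ k, ∑ i, ‖x k i‖ ^ 2 = 1) ∧ (∀ k, ∑ i, ‖y k i‖ ^ 2 = 1) ∧
    ρ = ∑ k, (p k : ℂ) • (vecMulVec (x k) (star (x k)) ⊗ₖ vecMulVec (y k) (star (y k)))

/-- `φ₁ = α|00⟩ + β|11⟩`. -/
noncomputable def φ₁ (α β : ℝ) : Fin 2 × Fin 2 → ℂ := fun q =>
  if q = (0, 0) then (α : ℂ) else if q = (1, 1) then (β : ℂ) else 0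

/-- `φ₂ = β|00⟩ + α|11⟩`. -/
noncomputable def φ₂ (α β : ℝ) : Fin 2 × Fin 2 → ℂ := fun q =>
  if q = (0, 0) then (β : ℂ) else if q = (1, 1) then (α : ℂ) else 0

/-- For `α > β > 0` with `α² + β² = 1`, the equal mixture
`(1/2)|φ₁⟩⟨φ₁| + (1/2)|φ₂⟩⟨φ₂|` is not separable. -/
theorem equal_mixture_entangled (α β : ℝ) (hβ : 0 < β) (hαβ : β < α)
    (h1 : α ^ 2 + β ^ 2 = 1) :
    ¬ IsSeparableState
      ((1 / 2 : ℂ) • vecMulVec (φ₁ α β) (star (φ₁ α β)) +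
        (1 / 2 : ℂ) • vecMulVec (φ₂ α β) (star (φ₂ α β))) := by
  rintro ⟨N, p, x, y, hp, -, -, -, h⟩
  have e1 := congrFun (congrFun h (0, 1)) (0, 1)
  have e2 := congrFun (congrFun h (0, 0)) (1, 1)
  simp only [Matrix.add_apply, Matrix.smul_apply, Matrix.sum_apply, vecMulVec_apply,
    kroneckerMap_apply, Pi.star_apply, smul_eq_mul] at e1 e2
  have e3 : ∑ k, p k * (‖x k 0‖ ^ 2 * ‖y k 1‖ ^ 2) = 0 := by
    have e4 : ((∑ k, p k * (‖x k 0‖ ^ 2 * ‖y k 1‖ ^ 2) : ℝ) : ℂ) = 0 := by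
      push_cast
      simp only [← Complex.mul_conj']
      simpa [φ₁, φ₂] using e1.symm
    exact_mod_cast e4
  rw [Finset.sum_eq_zero_iff_of_nonneg
    (fun k _ => mul_nonneg (hp k) (by positivity))] at e3
  have e5 : ∑ k, (p k : ℂ) * (x k 0 * star (x k 1) * (y k 0 * star (y k 1))) = 0 := by
    apply Finset.sum_eq_zero
    intro k hk
    have := e3 k hk
    simp only [mul_eq_zero, pow_eq_zero_iff, ne_eq, OfNat.ofNat_ne_zero, not_false_eq_true,
      norm_eq_zero] at this
    rcases this with h | h | h <;> simp [h]
  rw [e5] at e2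
  simp [φ₁, φ₂] at e2
  have e6 : (1/2 : ℝ) * (α * β) + 1/2 * (β * α) = 0 := by
    have e7 : (((1/2 : ℝ) * (α * β) + 1/2 * (β * α) : ℝ) : ℂ) = 0 := by
      push_cast
      rw [← e2]
      ring
    exact_mod_cast e7
  nlinarith [mul_pos hβ (hβ.trans hαβ)]
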